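/- Let A_{k,n} be the number of partitions of the cyclically ordered set {1,...,n} into exactly k blocks with no two cyclically consecutive elements (including the pair n,1) in the same block. Then for n ≥ 2 and 2 ≤ k ≤ n, A_{k,n} = (-1)^k · Σ_{j=2}^{k} [(-1)^j / (j!·(k-j)!)] · ((j-1)^n + (-1)^n (j-1)). -/

import Mathlib

open Finset

/-- The cyclic successor of `i : Fin n`. -/
def cycSucc {n : ℕ} (i : Fin n) : Fin n := ⟨(i.1 + 1) % n, Nat.mod_lt _ i.pos⟩

/-- `cyclicPartitionCount k n` is the number `A_{k,n}` of partitions of the cyclically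
ordered set `{1,…,n}` into exactly `k` nonempty blocks such that no block contains two
cyclically consecutive elements. -/
noncomputable def cyclicPartitionCount (k n : ℕ) : ℕ :=
  Nat.card {P : Finpartition (Finset.univ : Finset (Fin n)) //
    P.parts.card = k ∧ ∀ b ∈ P.parts, ∀ i : Fin n, i ∈ b → cycSucc i ∉ b}

/-- Indicator that a sequence has no two equal consecutive entries. -/
noncomputable def linInd {α : Type*} [DecidableEq α] (n : ℕ) (f : Fin (n + 1) → α) : ℚ :=
  if ∀ i : Fin n, f i.castSucc ≠ f i.succ then 1 else 0

lemma linInd_sum {α : Type*} [DecidableEq α] [Fintype α] (n : ℕ) (φ : α → α → ℚ) :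
    ∑ f : Fin (n + 2) → α, linInd (n + 1) f * φ (f 0) (f (Fin.last _)) =
      ∑ g : Fin (n + 1) → α, linInd n g *
        ∑ x : α, (if g (Fin.last _) ≠ x then 1 else 0) * φ (g 0) x := by
  rw [← (Fin.snocEquiv (fun _ : Fin (n + 2) => α)).sum_comp, Fintype.sum_prod_type_right]
  refine Finset.sum_congr rfl fun g _ => ?_
  rw [Finset.mul_sum]
  refine Finset.sum_congr rfl fun x _ => ?_
  have h0 : (Fin.snoc (α := fun _ : Fin (n + 2) => α) g x) 0 = g 0 := by
    rw [← Fin.castSucc_zero, Fin.snoc_castSucc]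
  have hl : linInd (n + 1) (Fin.snoc (α := fun _ : Fin (n + 2) => α) g x)
      = linInd n g * (if g (Fin.last _) ≠ x then 1 else 0) := by
    unfold linInd
    simp only [Fin.forall_fin_succ' (n := n), Fin.snoc_castSucc, Fin.succ_last, Fin.snoc_last, ← Fin.castSucc_succ]
    split_ifs <;> simp_all
  simp only [Fin.snocEquiv, Equiv.coe_fn_mk]
  rw [hl, h0, Fin.snoc_last]
  ring

lemma lin_count {α : Type*} [DecidableEq α] [Fintype α] (n : ℕ) :
    ∑ f : Fin (n + 1) → α, linInd n f = (Fintype.card α : ℚ) * ((Fintype.card α : ℚ) - 1) ^ n := by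
  induction n with
  | zero => simp [linInd]
  | succ n ih =>
    have := linInd_sum (α := α) n (fun _ _ => 1)
    simp only [mul_one] at this
    rw [this]
    have h : ∀ y : α, ∑ x : α, (if y ≠ x then (1 : ℚ) else 0) = (Fintype.card α : ℚ) - 1 := by
      intro y
      have : ∀ x : α, (if y ≠ x then (1 : ℚ) else 0) = 1 - if y = x then 1 else 0 := by
        intro x; split_ifs <;> simp_all
      simp [this]
    simp only [h]
    rw [← Finset.sum_mul, ih]
    ring

lemma cyc_sum {α : Type*} [DecidableEq α] [Fintype α] (n : ℕ) :
    ∑ f : Fin (n + 1) → α, linInd n f * (if f 0 ≠ f (Fin.last _) then 1 else 0) =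
      ((Fintype.card α : ℚ) - 1) ^ (n + 1) + (-1) ^ (n + 1) * ((Fintype.card α : ℚ) - 1) := by
  induction n with
  | zero => simp
  | succ n ih =>
    rw [linInd_sum n (fun a b => if a ≠ b then 1 else 0)]
    have h : ∀ a y : α, ∑ x : α, (if y ≠ x then (1 : ℚ) else 0) * (if a ≠ x then 1 else 0)
        = ((Fintype.card α : ℚ) - 1) - if a ≠ y then 1 else 0 := by
      intro a y
      have : ∀ x : α, (if y ≠ x then (1 : ℚ) else 0) * (if a ≠ x then 1 else 0)
          = 1 - (if y = x then 1 else 0) - (if a = x then 1 else 0)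
            + (if y = x then (if a = y then 1 else 0) else 0) := by
        intro x; split_ifs <;> simp_all
      simp only [this, Finset.sum_add_distrib, Finset.sum_sub_distrib]
      simp
      split_ifs <;> ring
    simp only [h, mul_sub, Finset.sum_sub_distrib]
    rw [ih, ← Finset.sum_mul]
    simp only [mul_one]
    rw [lin_count]
    ring

/-- Proper cyclic colorings. -/
def CycProper {α : Type*} {n : ℕ} (f : Fin n → α) : Prop := ∀ i, f i ≠ f (cycSucc i)

lemma cycProper_iff {α : Type*} {n : ℕ} (f : Fin (n + 1) → α) :
    CycProper f ↔ (∀ i : Fin n, f i.castSucc ≠ f i.succ) ∧ f 0 ≠ f (Fin.last _) := by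
  unfold CycProper
  rw [Fin.forall_fin_succ']
  have h1 : ∀ i : Fin n, cycSucc i.castSucc = i.succ := by
    intro i; ext; simp [cycSucc, Nat.mod_eq_of_lt]
  have h2 : cycSucc (Fin.last n) = 0 := by
    ext; simp [cycSucc]
  simp only [h1, h2]
  rw [ne_comm (a := f 0)]

lemma cyc_count {α : Type*} [Fintype α] (n : ℕ) (hn : 1 ≤ n) :
    (Nat.card {f : Fin n → α // CycProper f} : ℚ) =
      ((Fintype.card α : ℚ) - 1) ^ n + (-1) ^ n * ((Fintype.card α : ℚ) - 1) := by
  classical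
  obtain ⟨n, rfl⟩ : ∃ m, n = m + 1 := ⟨n - 1, by omega⟩
  rw [← cyc_sum, Nat.card_eq_fintype_card, Fintype.card_subtype, Finset.card_filter]
  push_cast
  refine Finset.sum_congr rfl fun f _ => ?_
  simp only [cycProper_iff, linInd]
  split_ifs <;> simp_all

lemma avoid_count (n k : ℕ) (hn : 1 ≤ n) (t : Finset (Fin k)) :
    (Nat.card {f : {f : Fin n → Fin k // CycProper f} // ∀ c ∈ t, ∀ i, f.1 i ≠ c} : ℚ) =
      ((k - #t : ℕ) - 1 : ℚ) ^ n + (-1) ^ n * ((k - #t : ℕ) - 1 : ℚ) := by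
  classical
  have e : {f : {f : Fin n → Fin k // CycProper f} // ∀ c ∈ t, ∀ i, f.1 i ≠ c} ≃
      {f : Fin n → {c : Fin k // c ∉ t} // CycProper f} :=
    { toFun := fun f => ⟨fun i => ⟨f.1.1 i, fun h => f.2 _ h i rfl⟩, fun i h =>
        f.1.2 i (congrArg Subtype.val h)⟩
      invFun := fun f => ⟨⟨fun i => (f.1 i).1, fun i h => f.2 i (Subtype.ext h)⟩,
        fun c hc i h => (f.1 i).2 (by
          change (f.1 i).1 = c at h
          rw [h]; exact hc)⟩
      left_inv := fun f => rfl
      right_inv := fun f => rfl }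
  rw [Nat.card_congr e, cyc_count n hn]
  have : Fintype.card {c : Fin k // c ∉ t} = k - #t := by
    simp [Fintype.card_subtype_compl]
  rw [this]

lemma surj_count (n k : ℕ) (hn : 1 ≤ n) :
    (Nat.card {f : {f : Fin n → Fin k // CycProper f} // Function.Surjective f.1} : ℚ) =
      ∑ j ∈ range (k + 1), (k.choose j : ℚ) * ((-1) ^ (k - j) *
        (((j : ℚ) - 1) ^ n + (-1) ^ n * ((j : ℚ) - 1))) := by
  classical
  have key := Finset.inclusion_exclusion_card_inf_compl (univ : Finset (Fin k))
    (fun c => univ.filter fun f : {f : Fin n → Fin k // CycProper f} => ∀ i, f.1 i ≠ c)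
  have h1 : ∀ t : Finset (Fin k), ((#(t.inf
      (fun c => univ.filter fun f : {f : Fin n → Fin k // CycProper f} => ∀ i, f.1 i ≠ c)) : ℕ) : ℚ)
      = ((k - #t : ℕ) - 1 : ℚ) ^ n + (-1) ^ n * ((k - #t : ℕ) - 1 : ℚ) := by
    intro t
    rw [← avoid_count n k hn t, Nat.card_eq_fintype_card, Fintype.card_subtype]
    congr 2
    ext f
    simp [Finset.mem_inf]
  have h2 : Nat.card {f : {f : Fin n → Fin k // CycProper f} // Function.Surjective f.1} =
      #((univ : Finset (Fin k)).inf fun c => (univ.filter fun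
        f : {f : Fin n → Fin k // CycProper f} => ∀ i, f.1 i ≠ c)ᶜ) := by
    rw [Nat.card_eq_fintype_card, Fintype.card_subtype]
    congr 1
    ext f
    rw [Finset.mem_filter]
    simp [Finset.mem_inf, Function.Surjective]
  rw [h2]
  have key' := congrArg (Int.cast : ℤ → ℚ) key
  push_cast at key'
  rw [key']
  simp only [h1]
  rw [Finset.sum_powerset_apply_card (fun m => (-1 : ℚ) ^ m *
    (((k - m : ℕ) - 1 : ℚ) ^ n + (-1) ^ n * ((k - m : ℕ) - 1 : ℚ)))]
  rw [← Finset.sum_range_reflect, Finset.card_univ, Fintype.card_fin]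
  refine Finset.sum_congr rfl fun j hj => ?_
  have hj : j ≤ k := by simpa [Nat.lt_succ_iff] using hj
  have e1 : k + 1 - 1 - j = k - j := by omega
  rw [e1, Nat.choose_symm hj, Nat.sub_sub_self hj, nsmul_eq_mul]

lemma partition_count (n k : ℕ) :
    Nat.card {f : {f : Fin n → Fin k // CycProper f} // Function.Surjective f.1} =
      cyclicPartitionCount k n * k.factorial := by
  classical
  let X := {P : Finpartition (Finset.univ : Finset (Fin n)) //
    P.parts.card = k ∧ ∀ b ∈ P.parts, ∀ i : Fin n, i ∈ b → cycSucc i ∉ b}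
  let Φ : (Σ P : X, (P.1.parts ≃ Fin k)) →
      {f : {f : Fin n → Fin k // CycProper f} // Function.Surjective f.1} := fun p =>
    ⟨⟨fun i => p.2 ⟨p.1.1.part i, p.1.1.part_mem.2 (mem_univ i)⟩, by
      intro i h
      have h' : p.1.1.part i = p.1.1.part (cycSucc i) := by simpa using h
      refine p.1.2.2 _ (p.1.1.part_mem.2 (mem_univ i)) i (p.1.1.mem_part (mem_univ i)) ?_
      rw [h']
      exact p.1.1.mem_part (mem_univ _)⟩, by
      intro c
      obtain ⟨x, hx⟩ := p.1.1.nonempty_of_mem_parts (p.2.symm c).2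
      refine ⟨x, ?_⟩
      have : (⟨p.1.1.part x, p.1.1.part_mem.2 (mem_univ x)⟩ : p.1.1.parts) = p.2.symm c :=
        Subtype.ext (p.1.1.part_eq_of_mem (p.2.symm c).2 hx)
      simp [this]⟩
  have hinj : Function.Injective Φ := by
    rintro ⟨⟨P, hP⟩, e⟩ ⟨⟨Q, hQ⟩, e'⟩ h
    have hf : ∀ i, e ⟨P.part i, P.part_mem.2 (mem_univ i)⟩ =
        e' ⟨Q.part i, Q.part_mem.2 (mem_univ i)⟩ := fun i =>
      congrFun (congrArg Subtype.val (congrArg Subtype.val h)) i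
    have hpart : ∀ i, P.part i = Q.part i := by
      intro i
      ext j
      rw [P.mem_part_iff_part_eq_part (mem_univ j) (mem_univ i),
        Q.mem_part_iff_part_eq_part (mem_univ j) (mem_univ i)]
      have h1 := hf i
      have h2 := hf j
      constructor
      · intro hh
        have : e' ⟨Q.part j, Q.part_mem.2 (mem_univ j)⟩ =
          e' ⟨Q.part i, Q.part_mem.2 (mem_univ i)⟩ := by
            rw [← h1, ← h2]; simp [hh]
        simpa using this
      · intro hh
        have : e ⟨P.part j, P.part_mem.2 (mem_univ j)⟩ =
          e ⟨P.part i, P.part_mem.2 (mem_univ i)⟩ := by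
            rw [h1, h2]; simp [hh]
        simpa using this
    have himg : ∀ R : Finpartition (univ : Finset (Fin n)), R.parts = univ.image R.part := by
      intro R
      ext b
      simp only [mem_image, mem_univ, true_and]
      constructor
      · intro hb
        obtain ⟨x, hx⟩ := R.nonempty_of_mem_parts hb
        exact ⟨x, R.part_eq_of_mem hb hx⟩
      · rintro ⟨x, rfl⟩
        exact R.part_mem.2 (mem_univ x)
    have hPQ : P = Q := by
      apply Finpartition.ext
      rw [himg P, himg Q, funext hpart]
    subst hPQ
    have : e = e' := by
      ext ⟨b, hb⟩
      obtain ⟨x, hx⟩ := P.nonempty_of_mem_parts hb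
      obtain rfl := P.part_eq_of_mem hb hx
      rw [hf x]
    rw [this]
  have hsurj : Function.Surjective Φ := by
    rintro ⟨⟨f, hf⟩, hs⟩
    change Function.Surjective f at hs
    let P : Finpartition (univ : Finset (Fin n)) := Finpartition.ofSetoid (Setoid.ker f)
    have hP : ∀ i j, j ∈ P.part i ↔ f i = f j := fun i j =>
      Finpartition.mem_part_ofSetoid_iff_rel
    have hs' := hs
    choose r hr using hs'
    have hP' : ∀ i j, f i = f j → P.part i = P.part j := fun i j h =>
      (P.mem_part_iff_part_eq_part (mem_univ _) (mem_univ _)).1 ((hP j i).2 h.symm)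
    let g : Fin k → P.parts := fun c => ⟨P.part (r c), P.part_mem.2 (mem_univ _)⟩
    have hg : Function.Bijective g := by
      constructor
      · intro c c' h
        have h' : P.part (r c) = P.part (r c') := congrArg Subtype.val h
        have := (hP (r c) (r c')).1 (by rw [h']; exact P.mem_part (mem_univ _))
        rwa [hr, hr] at this
      · rintro ⟨b, hb⟩
        obtain ⟨x, hx⟩ := P.nonempty_of_mem_parts hb
        refine ⟨f x, Subtype.ext ?_⟩
        exact (hP' _ _ (hr _)).trans (P.part_eq_of_mem hb hx)
    let e := Equiv.ofBijective g hg
    refine ⟨⟨⟨P, ?_, ?_⟩, e.symm⟩, ?_⟩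
    · simpa using (Fintype.card_congr e).symm
    · intro b hb i hi hi'
      rw [← P.part_eq_of_mem hb hi] at hi'
      exact hf i ((hP _ _).1 hi')
    · apply Subtype.ext
      apply Subtype.ext
      funext i
      change e.symm ⟨P.part i, _⟩ = f i
      rw [Equiv.symm_apply_eq]
      apply Subtype.ext
      exact (hP' _ _ (hr _)).symm
  rw [← Nat.card_congr (Equiv.ofBijective Φ ⟨hinj, hsurj⟩), Nat.card_sigma]
  have : ∀ P : X, Nat.card (P.1.parts ≃ Fin k) = k.factorial := by
    intro P
    have e0 : P.1.parts ≃ Fin k := Fintype.equivFinOfCardEq (by simpa using P.2.1)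
    rw [Nat.card_eq_fintype_card, Fintype.card_equiv e0]
    simp [P.2.1]
  simp only [this]
  rw [Finset.sum_const, smul_eq_mul, Finset.card_univ, ← Nat.card_eq_fintype_card]
  rfl

theorem cyclicPartitionCount_formula (n k : ℕ) (hn : 2 ≤ n) (hk2 : 2 ≤ k) (hkn : k ≤ n) :
    (cyclicPartitionCount k n : ℚ) =
      (-1) ^ k * ∑ j ∈ Icc 2 k,
        ((-1) ^ j / ((j.factorial : ℚ) * ((k - j).factorial : ℚ))) *
          (((j : ℚ) - 1) ^ n + (-1) ^ n * ((j : ℚ) - 1)) := by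
  have h := surj_count n k (by omega)
  rw [partition_count] at h
  push_cast at h
  have hk : (k.factorial : ℚ) ≠ 0 := by exact_mod_cast k.factorial_ne_zero
  rw [← mul_left_inj' hk, h, Finset.mul_sum, Finset.sum_mul]
  symm
  have hsub : Icc 2 k ⊆ range (k + 1) := by
    intro j hj
    simp only [Finset.mem_Icc] at hj
    simp only [Finset.mem_range]
    omega
  rw [← Finset.sum_subset hsub]
  · refine Finset.sum_congr rfl fun j hj => ?_
    have hj : j ≤ k := (Finset.mem_Icc.1 hj).2
    rw [Nat.cast_choose ℚ hj]
    have hs : (-1 : ℚ) ^ (k - j) = (-1) ^ k * (-1) ^ j := by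
      obtain ⟨d, rfl⟩ := Nat.exists_eq_add_of_le hj
      rw [Nat.add_sub_cancel_left, pow_add, mul_right_comm, ← mul_pow]
      simp
    rw [hs]
    ring
  · intro j hj hj'
    have : j = 0 ∨ j = 1 := by
      simp only [Finset.mem_Icc, Finset.mem_range] at hj hj'
      omega
    rcases this with rfl | rfl
    · simp
    · have : n ≠ 0 := by omega
      simp [this]
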